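/- No 1-random set is introenumerable. -/

import Mathlib

open MeasureTheory

/-- A set (of any primcodable type) is computably enumerable. -/
def CE {α : Type*} [Primcodable α] (S : Set α) : Prop :=
  ∃ f : α →. ℕ, Partrec f ∧ S = f.Dom

/-- The `y`-th finite set in a canonical listing of all finite subsets of `ℕ`. -/
def Dfin (y : ℕ) : Set ℕ := ↑(Denumerable.ofNat (Finset ℕ) y)

/-- Application of the enumeration operator with c.e. index set `W` to an oracle `X`. -/
def enumOp (W : Set ℕ) (X : Set ℕ) : Set ℕ :=
  {x | ∃ y, Nat.pair x y ∈ W ∧ Dfin y ⊆ X}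

/-- Enumeration reducibility. -/
def EnumRed (A B : Set ℕ) : Prop := ∃ W : Set ℕ, CE W ∧ A = enumOp W B

/-- Enumeration equivalence. -/
def EnumEquiv (A B : Set ℕ) : Prop := EnumRed A B ∧ EnumRed B A

/-- Application of a hyper-enumeration operator with c.e. index set `W` to an oracle `X`. -/
def henumOp (W : Set ℕ) (X : Set ℕ) : Set ℕ :=
  {x | ∀ f : List ℕ, ∃ n y,
    Nat.pair (Encodable.encode (f.take n)) (Nat.pair x y) ∈ W ∧ Dfin y ⊆ X}

/-- Hyper-enumeration reducibility. -/
def HypEnumRed (B A : Set ℕ) : Prop := ∃ W : Set ℕ, CE W ∧ B = henumOp W A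

def Cototal (A : Set ℕ) : Prop := EnumRed A Aᶜ

def HypCototal (A : Set ℕ) : Prop := HypEnumRed A Aᶜ

def UnifIntroenum (X : Set ℕ) : Prop :=
  X.Infinite ∧ ∃ W : Set ℕ, CE W ∧ ∀ Y ⊆ X, Y.Infinite → enumOp W Y = X

def Introenum (X : Set ℕ) : Prop :=
  X.Infinite ∧ ∀ Y ⊆ X, Y.Infinite → ∃ W : Set ℕ, CE W ∧ enumOp W Y = X

/-- View a point of Cantor space as a subset of `ℕ`. -/
def toSet (A : ℕ → Bool) : Set ℕ := {n | A n = true}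

/-- Remove `n` from (the set coded by) `A`. -/
def drop (A : ℕ → Bool) (n : ℕ) : ℕ → Bool := fun m => if m = n then false else A m

/-- `A` is `Ψ`-autoreducible. -/
def AutoRed (Ψ : ℕ → (ℕ → Bool) → Bool) (A : ℕ → Bool) : Prop :=
  ∀ n, A n = Ψ n (drop A n)

/-- The basic clopen cylinder of a finite binary string. -/
def cyl (σ : List Bool) : Set (ℕ → Bool) := {A | ∀ i : Fin σ.length, A i = σ.get i}

/-- `μ` is the uniform (fair-coin) measure on Cantor space: it gives each cylinder
of a string of length `k` measure `2⁻ᵏ`.  (This characterizes the measure uniquely.) -/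
def IsCoinMeasure (μ : Measure (ℕ → Bool)) : Prop :=
  ∀ σ : List Bool, μ (cyl σ) = 2⁻¹ ^ σ.length

/-- The first `k` bits of `A`. -/
def res (A : ℕ → Bool) (k : ℕ) : List Bool := List.ofFn fun i : Fin k => A i

/-- A `Π⁰₂` class in Cantor space. -/
def IsPi02 (C : Set (ℕ → Bool)) : Prop :=
  ∃ R : ℕ → List Bool → Bool, Computable (fun p : ℕ × List Bool => R p.1 p.2) ∧
    C = {A | ∀ m, ∃ k, R m (res A k) = true}

/-- A `Π⁰₃` class in Cantor space. -/
def IsPi03 (C : Set (ℕ → Bool)) : Prop :=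
  ∃ R : ℕ → ℕ → List Bool → Bool,
    Computable (fun p : ℕ × ℕ × List Bool => R p.1 p.2.1 p.2.2) ∧
    C = {A | ∀ m, ∃ k, ∀ j, R m k (res A j) = true}

/-- The `m`-th level of the open test determined by the c.e. set `W` of pairs. -/
def testSet (W : Set (ℕ × List Bool)) (m : ℕ) : Set (ℕ → Bool) :=
  ⋃ σ ∈ {σ | (m, σ) ∈ W}, cyl σ

/-- Martin-Löf randomness (with respect to a measure `μ` on Cantor space). -/
def MLRandom (μ : Measure (ℕ → Bool)) (A : ℕ → Bool) : Prop :=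
  ∀ W : Set (ℕ × List Bool), CE W →
    (∀ m, μ (testSet W m) ≤ 2⁻¹ ^ m) → ∃ m, A ∉ testSet W m

/-- 2-randomness: passing all uniformly `Σ⁰₂` tests. -/
def TwoRandom (μ : Measure (ℕ → Bool)) (A : ℕ → Bool) : Prop :=
  ∀ R : ℕ → ℕ → List Bool → Bool,
    Computable (fun p : ℕ × ℕ × List Bool => R p.1 p.2.1 p.2.2) →
    (∀ m, μ {A | ∃ k, ∀ j, R m k (res A j) = true} ≤ 2⁻¹ ^ m) →
    ∃ m, A ∉ {A | ∃ k, ∀ j, R m k (res A j) = true}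

/-- Weak 2-randomness: avoiding every null `Π⁰₂` class. -/
def Weak2Random (μ : Measure (ℕ → Bool)) (A : ℕ → Bool) : Prop :=
  ∀ C : Set (ℕ → Bool), IsPi02 C → μ C = 0 → A ∉ C

/-- Weak 3-randomness: avoiding every null `Π⁰₃` class. -/
def Weak3Random (μ : Measure (ℕ → Bool)) (A : ℕ → Bool) : Prop :=
  ∀ C : Set (ℕ → Bool), IsPi03 C → μ C = 0 → A ∉ C

open Nat.Partrec (Code)
open Nat.Partrec.Code (evaln eval)

namespace S19

/-! ### Decidable approximation -/

def inE (c : Code) (F : List ℕ) (n : ℕ) (σ : List Bool) (x : ℕ) : Prop :=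
  ∃ y < σ.length, (evaln σ.length c (Nat.pair x y)).isSome = true ∧
    ∀ z ∈ Denumerable.raise' (Denumerable.ofNat (List ℕ) y) 0,
      z ∈ F ∨ (n ≤ z ∧ σ.getD z false = true)

def Good (c : Code) (F : List ℕ) (n : ℕ) (σ : List Bool) : Prop :=
  n ≤ σ.length ∧ ∀ x < n, (σ.getD x false = true ↔ inE c F n σ x)

theorem raise_foldl (l : List ℕ) : ∀ (acc : List ℕ) (o : ℕ),
    (l.foldl (fun (s : List ℕ × ℕ) m => (s.1 ++ [m + s.2], m + s.2 + 1)) (acc, o)).1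
      = acc ++ Denumerable.raise' l o := by
  induction l with
  | nil => intro acc o; simp [Denumerable.raise']
  | cons a l ih => intro acc o; simp [Denumerable.raise', ih]

theorem primrec_raise : Primrec fun y : ℕ =>
    Denumerable.raise' (Denumerable.ofNat (List ℕ) y) 0 := by
  have h : Primrec fun y : ℕ => ((Denumerable.ofNat (List ℕ) y).foldl
      (fun (s : List ℕ × ℕ) m => (s.1 ++ [m + s.2], m + s.2 + 1)) (([] : List ℕ), 0)).1 := by
    refine Primrec.fst.comp (Primrec.list_foldl (h := fun _ p =>
      (p.1.1 ++ [p.2 + p.1.2], p.2 + p.1.2 + 1)) (Primrec.ofNat (List ℕ)) (Primrec.const _) ?_)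
    have ha : Primrec fun q : ℕ × ((List ℕ × ℕ) × ℕ) => q.2.2 + q.2.1.2 :=
      Primrec.nat_add.comp (Primrec.snd.comp Primrec.snd)
        (Primrec.snd.comp (Primrec.fst.comp Primrec.snd))
    exact (Primrec.list_concat.comp (Primrec.fst.comp (Primrec.fst.comp Primrec.snd)) ha).pair
      (Primrec.succ.comp ha)
  exact h.of_eq fun y => by rw [raise_foldl]; simp

theorem Dfin_eq (y : ℕ) :
    Dfin y = {z | z ∈ Denumerable.raise' (Denumerable.ofNat (List ℕ) y) 0} := by
  ext z
  have : Denumerable.ofNat (Finset ℕ) y =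
      Finset.map (Denumerable.eqv ℕ).symm.toEmbedding
        (Denumerable.raise'Finset (Denumerable.ofNat (List ℕ) y) 0) := rfl
  simp only [Dfin, this, Set.mem_ofPred_eq]
  simp [Denumerable.raise'Finset, Denumerable.eqv]
  rfl

theorem primrec_getD : PrimrecPred fun p : List Bool × ℕ => p.1.getD p.2 false = true :=
  Primrec.eq.comp (Primrec.list_getD false) (Primrec.const true)

theorem primrec_inE (c : Code) (F : List ℕ) :
    PrimrecPred fun p : (ℕ × List Bool) × ℕ => inE c F p.1.1 p.1.2 p.2 := by
  have hF : PrimrecPred fun z : ℕ => z ∈ F := by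
    have := (PrimrecRel.exists_mem_list (Primrec.eq (α := ℕ))).comp (Primrec.const F)
      (Primrec.id (α := ℕ))
    exact this.of_eq fun z => by simp
  -- inner: R z (n,σ)
  have h1 : PrimrecRel fun (z : ℕ) (p : ℕ × List Bool) =>
      z ∈ F ∨ (p.1 ≤ z ∧ p.2.getD z false = true) := by
    refine PrimrecPred.or (hF.comp Primrec.fst) (PrimrecPred.and ?_ ?_)
    · exact Primrec.nat_le.comp (Primrec.fst.comp Primrec.snd) Primrec.fst
    · exact primrec_getD.comp ((Primrec.snd.comp Primrec.snd).pair Primrec.fst)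
  have h2 := h1.forall_mem_list
  have h3 : PrimrecRel fun (y : ℕ) (p : (ℕ × List Bool) × ℕ) =>
      (evaln p.1.2.length c (Nat.pair p.2 y)).isSome = true ∧
    ∀ z ∈ Denumerable.raise' (Denumerable.ofNat (List ℕ) y) 0,
      z ∈ F ∨ (p.1.1 ≤ z ∧ p.1.2.getD z false = true) := by
    refine PrimrecPred.and ?_ ?_
    · refine Primrec.eq.comp (Primrec.option_isSome.comp ?_) (Primrec.const true)
      refine Nat.Partrec.Code.primrec_evaln.comp (Primrec.pair (Primrec.pair ?_ (Primrec.const c)) ?_)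
      · exact Primrec.list_length.comp (Primrec.snd.comp (Primrec.fst.comp Primrec.snd))
      · exact Primrec₂.natPair.comp (Primrec.snd.comp Primrec.snd) Primrec.fst
    · exact h2.comp (primrec_raise.comp Primrec.fst) (Primrec.fst.comp Primrec.snd)
  have h4 := h3.exists_mem_list
  exact (h4.comp (Primrec.list_range.comp
    (Primrec.list_length.comp (Primrec.snd.comp Primrec.fst))) Primrec.id).of_eq
    fun p => by simp [inE]

theorem primrec_Good (c : Code) (F : List ℕ) :
    PrimrecPred fun p : ℕ × List Bool => Good c F p.1 p.2 := by
  have hE := primrec_inE c F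
  have h1 : PrimrecRel fun (x : ℕ) (p : ℕ × List Bool) =>
      (p.2.getD x false = true ↔ inE c F p.1 p.2 x) := by
    have a : PrimrecPred fun q : ℕ × (ℕ × List Bool) => q.2.2.getD q.1 false = true :=
      primrec_getD.comp ((Primrec.snd.comp Primrec.snd).pair Primrec.fst)
    have b : PrimrecPred fun q : ℕ × (ℕ × List Bool) => inE c F q.2.1 q.2.2 q.1 :=
      hE.comp (Primrec.snd.pair Primrec.fst)
    exact ((a.and b).or (a.not.and b.not)).of_eq fun q => by tauto
  have h2 := h1.forall_mem_list
  exact PrimrecPred.and (Primrec.nat_le.comp Primrec.fst (Primrec.list_length.comp Primrec.snd))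
    ((h2.comp (Primrec.list_range.comp Primrec.fst) Primrec.id).of_eq fun p => by simp)

def test (c : Code) (F : List ℕ) (n₀ : ℕ) : Set (ℕ × List Bool) :=
  {p | Good c F (3 * p.1 + n₀) p.2}

theorem CE_of_primrec {α : Type*} [Primcodable α] {p : α → Prop} (h : PrimrecPred p) :
    CE {a | p a} := by
  have h1 : REPred p := h.computablePred.to_re
  refine ⟨_, (Partrec.map h1 ((Computable.const 0).to₂ : Computable₂ fun _ _ => (0 : ℕ))), ?_⟩
  ext a
  simp [PFun.Dom, Part.assert]

theorem CE_test (c : Code) (F : List ℕ) (n₀ : ℕ) : CE (test c F n₀) := by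
  apply CE_of_primrec
  refine (primrec_Good c F).comp (Primrec.pair ?_ Primrec.snd)
  exact Primrec.nat_add.comp (Primrec.nat_mul.comp (Primrec.const 3) Primrec.fst)
    (Primrec.const n₀)

/-! ### Measure bound -/

theorem mem_cyl {σ : List Bool} {X : ℕ → Bool} :
    X ∈ cyl σ ↔ ∀ (i : ℕ) (h : i < σ.length), X i = σ[i] := by
  simp only [cyl, Set.mem_ofPred_eq]
  constructor
  · intro h i hi
    simpa using h ⟨i, hi⟩
  · intro h i
    simpa using h i i.2

theorem cyl_anti {σ τ : List Bool} (h : σ <+: τ) : cyl τ ⊆ cyl σ := by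
  intro X hX
  rw [mem_cyl] at *
  intro i hi
  rw [hX i (lt_of_lt_of_le hi h.length_le), h.getElem]

theorem prefix_of_mem {σ τ : List Bool} {X : ℕ → Bool} (h1 : X ∈ cyl σ) (h2 : X ∈ cyl τ)
    (h : σ.length ≤ τ.length) : σ <+: τ := by
  rw [mem_cyl] at *
  rw [List.prefix_iff_eq_take]
  apply List.ext_getElem
  · simp [h]
  · intro i hi hi'
    rw [List.getElem_take, ← h1 i hi, ← h2 i]

theorem meas_cyl (σ : List Bool) : MeasurableSet (cyl σ) := by
  have : cyl σ = ⋂ i : Fin σ.length, (fun X : ℕ → Bool => X i) ⁻¹' {σ.get i} := by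
    ext X; simp [cyl]
  rw [this]
  exact MeasurableSet.iInter fun i => measurable_pi_apply _ (MeasurableSet.singleton _)

theorem measure_bound (μ : Measure (ℕ → Bool)) (hμ : IsCoinMeasure μ) (n : ℕ)
    (S : Set (List Bool)) (hn : ∀ σ ∈ S, n ≤ σ.length)
    (hS : ∀ σ ∈ S, ∀ σ' ∈ S, σ.drop n <+: σ'.drop n → σ.take n = σ'.take n) :
    μ (⋃ σ ∈ S, cyl σ) ≤ 2⁻¹ ^ n := by
  classical
  let T : Set (List Bool) :=
    {τ | (∃ σ ∈ S, σ.drop n = τ) ∧ ∀ σ ∈ S, σ.drop n <+: τ → σ.drop n = τ}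
  have hT : ∀ τ : T, ∃ σ ∈ S, σ.drop n = τ.1 := fun τ => τ.2.1
  choose g hgS hg using hT
  have hmin : ∀ N, ∀ σ ∈ S, σ.length = N → ∃ τ : T, τ.1 <+: σ.drop n := by
    intro N
    induction N using Nat.strong_induction_on with
    | _ N ih =>
      intro σ hσ hN
      by_cases h : ∀ σ' ∈ S, σ'.drop n <+: σ.drop n → σ'.drop n = σ.drop n
      · exact ⟨⟨σ.drop n, ⟨σ, hσ, rfl⟩, h⟩, List.prefix_rfl⟩
      · push Not at h
        obtain ⟨σ', hσ', hp, hne⟩ := h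
        have hlt : σ'.length < N := by
          have h1 := hp.length_le
          have h2 : (σ'.drop n).length ≠ (σ.drop n).length := fun e => hne (hp.eq_of_length e)
          have := hn _ hσ; have := hn _ hσ'
          simp only [List.length_drop] at h1 h2
          omega
        obtain ⟨τ, hτ⟩ := ih _ hlt σ' hσ' rfl
        exact ⟨τ, hτ.trans hp⟩
  have hsub : (⋃ σ ∈ S, cyl σ) ⊆ ⋃ τ : T, cyl (g τ) := by
    refine Set.iUnion₂_subset fun σ hσ => ?_
    obtain ⟨τ, hτ⟩ := hmin _ σ hσ rfl
    refine Set.Subset.trans (cyl_anti ?_) (Set.subset_iUnion (fun τ : T => cyl (g τ)) τ)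
    have h1 : (g τ).take n = σ.take n := hS _ (hgS τ) _ hσ (by rw [hg]; exact hτ)
    rw [← List.take_append_drop n (g τ), ← List.take_append_drop n σ, h1, hg]
    exact (List.prefix_append_right_inj _).2 hτ
  have hdisj : Pairwise (Function.onFun Disjoint fun τ : T => cyl τ.1) := by
    intro τ τ' hne
    rw [Function.onFun, Set.disjoint_left]
    intro X hX hX'
    apply hne
    apply Subtype.ext
    rcases le_total τ.1.length τ'.1.length with h | h
    · have := prefix_of_mem hX hX' h
      have h2 := τ'.2.2 _ (hgS τ) (by rw [hg]; exact this)
      rw [hg] at h2; exact h2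
    · have := prefix_of_mem hX' hX h
      have h2 := τ.2.2 _ (hgS τ') (by rw [hg]; exact this)
      rw [hg] at h2; exact h2.symm
  have huniv : μ Set.univ = 1 := by
    have := hμ []
    simpa [cyl] using this
  calc μ (⋃ σ ∈ S, cyl σ) ≤ μ (⋃ τ : T, cyl (g τ)) := measure_mono hsub
    _ ≤ ∑' τ : T, μ (cyl (g τ)) := measure_iUnion_le _
    _ = ∑' τ : T, 2⁻¹ ^ n * μ (cyl τ.1) := by
        congr 1; ext τ
        rw [hμ, hμ, ← pow_add]
        congr 1
        have := hn _ (hgS τ)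
        rw [← hg τ, List.length_drop]; omega
    _ = 2⁻¹ ^ n * ∑' τ : T, μ (cyl τ.1) := ENNReal.tsum_mul_left
    _ = 2⁻¹ ^ n * μ (⋃ τ : T, cyl τ.1) := by
        rw [measure_iUnion hdisj fun τ => meas_cyl _]
    _ ≤ 2⁻¹ ^ n * 1 := by
        gcongr
        exact (measure_mono (Set.subset_univ _)).trans huniv.le
    _ = 2⁻¹ ^ n := mul_one _

theorem getD_mono {n : ℕ} {σ σ' : List Bool} 
    (h : σ.drop n <+: σ'.drop n) {z : ℕ} (hz : n ≤ z) (h2 : σ.getD z false = true) :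
    σ'.getD z false = true := by
  obtain ⟨k, rfl⟩ := Nat.exists_eq_add_of_le hz
  have e : ∀ ρ : List Bool, ρ.getD (n + k) false = (ρ.drop n).getD k false := by
    intro ρ; simp [List.getD_eq_getElem?_getD]
  rw [e] at *
  obtain ⟨t, ht⟩ := h
  rw [← ht]
  have hk : k < (σ.drop n).length := by
    by_contra hk
    rw [List.getD_eq_default _ _ (by omega)] at h2
    simp at h2
  rw [List.getD_append _ _ _ _ hk]
  exact h2

theorem isSome_mono {c : Code} {s t w : ℕ} (h : s ≤ t) (h1 : (evaln s c w).isSome = true) :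
    (evaln t c w).isSome = true := by
  rw [Option.isSome_iff_exists] at *
  obtain ⟨a, ha⟩ := h1
  exact ⟨a, Nat.Partrec.Code.evaln_mono h ha⟩

theorem inE_mono {c : Code} {F : List ℕ} {n : ℕ} {σ σ' : List Bool} (h1 : n ≤ σ.length)
    (h2 : n ≤ σ'.length) (h : σ.drop n <+: σ'.drop n) {x : ℕ} (hx : inE c F n σ x) :
    inE c F n σ' x := by
  have hl : σ.length ≤ σ'.length := by
    have := h.length_le
    simp only [List.length_drop] at this
    omega
  obtain ⟨y, hy, he, hz⟩ := hx
  refine ⟨y, by omega, isSome_mono hl he, fun z hz' => ?_⟩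
  rcases hz z hz' with h3 | ⟨h3, h4⟩
  · exact Or.inl h3
  · exact Or.inr ⟨h3, getD_mono h h3 h4⟩

def supp (n : ℕ) (σ : List Bool) : Finset ℕ :=
  (Finset.range n).filter fun x => σ.getD x false = true

theorem test_measure (μ : Measure (ℕ → Bool)) (hμ : IsCoinMeasure μ) (c : Code) (F : List ℕ)
    (n : ℕ) : μ (⋃ σ ∈ {σ | Good c F n σ}, cyl σ) ≤ (n + 1) * 2⁻¹ ^ n := by
  have hk : ∀ k, μ (⋃ σ ∈ {σ | Good c F n σ ∧ (supp n σ).card = k}, cyl σ) ≤ 2⁻¹ ^ n := by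
    intro k
    apply measure_bound μ hμ n _ (fun σ hσ => hσ.1.1)
    rintro σ ⟨h1, h2⟩ σ' ⟨h1', h2'⟩ hp
    have hs : supp n σ ⊆ supp n σ' := by
      intro x hx
      simp only [supp, Finset.mem_filter, Finset.mem_range] at *
      exact ⟨hx.1, (h1'.2 x hx.1).2 (inE_mono h1.1 h1'.1 hp ((h1.2 x hx.1).1 hx.2))⟩
    have he := Finset.eq_of_subset_of_card_le hs (by omega)
    apply List.ext_getElem
    · have := h1.1; have := h1'.1; simp; omega
    · intro i hi hi'
      simp only [List.length_take] at hi hi'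
      rw [List.getElem_take, List.getElem_take]
      have h3 : i ∈ supp n σ ↔ i ∈ supp n σ' := by rw [he]
      simp only [supp, Finset.mem_filter, Finset.mem_range] at h3
      rw [List.getD_eq_getElem _ _ (by omega), List.getD_eq_getElem _ _ (by omega)] at h3
      have hin : i < n := by omega
      simp only [hin, true_and] at h3
      exact Bool.eq_iff_iff.2 h3
  have hsub : (⋃ σ ∈ {σ | Good c F n σ}, cyl σ) ⊆
      ⋃ k ∈ Finset.range (n + 1), ⋃ σ ∈ {σ | Good c F n σ ∧ (supp n σ).card = k}, cyl σ := by
    refine Set.iUnion₂_subset fun σ hσ X hX => ?_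
    simp only [Set.mem_iUnion]
    refine ⟨(supp n σ).card, ?_, σ, ⟨hσ, rfl⟩, hX⟩
    have : (supp n σ).card ≤ n := by
      exact (Finset.card_filter_le _ _).trans (Finset.card_range n).le
    simp; omega
  calc _ ≤ _ := measure_mono hsub
    _ ≤ ∑ k ∈ Finset.range (n + 1), μ (⋃ σ ∈ {σ | Good c F n σ ∧ (supp n σ).card = k}, cyl σ) :=
        measure_biUnion_finset_le _ _
    _ ≤ ∑ k ∈ Finset.range (n + 1), 2⁻¹ ^ n := Finset.sum_le_sum fun k _ => hk k
    _ = (n + 1) * 2⁻¹ ^ n := by simp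

theorem arith (m n₀ : ℕ) : 3 * m + n₀ + 1 ≤ 2 ^ (2 * m + n₀) := by
  induction m with
  | zero => simpa using Nat.lt_two_pow_self (n := n₀)
  | succ m ih =>
    have : 2 ^ (2 * (m + 1) + n₀) = 4 * 2 ^ (2 * m + n₀) := by ring
    omega

theorem arith' (m n₀ : ℕ) :
    (((3 * m + n₀ : ℕ) : ENNReal) + 1) * 2⁻¹ ^ (3 * m + n₀) ≤ 2⁻¹ ^ m := by
  have e : 3 * m + n₀ = (2 * m + n₀) + m := by ring
  have h1 : (((3 * m + n₀ : ℕ) : ENNReal) + 1) ≤ 2 ^ (2 * m + n₀) := by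
    exact_mod_cast arith m n₀
  calc (((3 * m + n₀ : ℕ) : ENNReal) + 1) * 2⁻¹ ^ (3 * m + n₀)
      ≤ 2 ^ (2 * m + n₀) * 2⁻¹ ^ ((2 * m + n₀) + m) := by
        rw [← e]; gcongr
    _ = (2 * 2⁻¹) ^ (2 * m + n₀) * 2⁻¹ ^ m := by rw [pow_add, mul_pow]; ring
    _ = 2⁻¹ ^ m := by rw [ENNReal.mul_inv_cancel (by simp) (by simp)]; simp

/-! ### Key lemma -/

def Wc (c : Code) : Set ℕ := {w | ∃ s, (evaln s c w).isSome = true}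

theorem CE_code {W : Set ℕ} (h : CE W) : ∃ c, W = Wc c := by
  obtain ⟨f, hf, rfl⟩ := h
  obtain ⟨c, hc⟩ := Nat.Partrec.Code.exists_code.1 (Partrec.nat_iff.1 hf)
  refine ⟨c, ?_⟩
  ext w
  subst hc
  rw [PFun.mem_dom]
  simp only [Nat.Partrec.Code.evaln_complete, Wc, Set.mem_ofPred_eq, Option.isSome_iff_exists,
    Option.mem_def]
  exact exists_comm

theorem res_getD (A : ℕ → Bool) (s z : ℕ) :
    (res A s).getD z false = true ↔ z < s ∧ A z = true := by
  by_cases h : z < s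
  · rw [List.getD_eq_getElem _ _ (by simpa [res] using h)]
    simp [res, h]
  · rw [List.getD_eq_default _ _ (by simpa [res] using h)]
    simp [h]

theorem mem_cyl_res (A : ℕ → Bool) (s : ℕ) : A ∈ cyl (res A s) := by
  rw [mem_cyl]; intro i hi; simp [res]

theorem key (μ : Measure (ℕ → Bool)) (hμ : IsCoinMeasure μ)
    (A : ℕ → Bool) (h : MLRandom μ A) (c : Code) (F : Finset ℕ) (n₀ : ℕ) :
    ∃ n, n₀ ≤ n ∧ enumOp (Wc c) (F ∪ {z | n ≤ z ∧ A z = true}) ≠ toSet A := by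
  by_contra hcon
  push Not at hcon
  obtain ⟨m, hm⟩ := h (test c F.toList n₀) (CE_test _ _ _) fun m =>
    (test_measure μ hμ c F.toList (3 * m + n₀)).trans (arith' m n₀)
  apply hm
  set n := 3 * m + n₀ with hn
  have hE := hcon n (by omega)
  have hx : ∀ x, ∃ s, A x = true → ∀ t ≥ s, inE c F.toList n (res A t) x := by
    intro x
    by_cases hx : A x = true
    · have : x ∈ enumOp (Wc c) (F ∪ {z | n ≤ z ∧ A z = true}) := by rw [hE]; exact hx
      obtain ⟨y, ⟨s, hs⟩, hy⟩ := this
      obtain ⟨b, hb⟩ : ∃ b, ∀ z ∈ Dfin y, z < b := by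
        refine ⟨(Denumerable.ofNat (Finset ℕ) y).sup id + 1, fun z hz => ?_⟩
        exact Nat.lt_succ_of_le (Finset.le_sup (f := id) (Finset.mem_coe.1 hz))
      refine ⟨s + y + b + 1, fun _ t ht => ?_⟩
      have hl : (res A t).length = t := by simp [res]
      refine ⟨y, by omega, isSome_mono (by omega) hs, fun z hz => ?_⟩
      have hz' : z ∈ Dfin y := by rw [Dfin_eq]; exact hz
      rcases hy hz' with h1 | ⟨h1, h2⟩
      · left; simpa using h1
      · right; refine ⟨h1, (res_getD _ _ _).2 ⟨?_, h2⟩⟩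
        have := hb z hz'; omega
    · exact ⟨0, fun h => absurd h hx⟩
  choose s hs using hx
  let t := n + (Finset.range n).sup s
  have hl : (res A t).length = t := by simp [res]
  simp only [testSet, Set.mem_iUnion]
  refine ⟨res A t, ?_, mem_cyl_res A t⟩
  change Good c F.toList n (res A t)
  refine ⟨by omega, fun x hxn => ?_⟩
  have hst : s x ≤ t :=
    (Finset.le_sup (f := s) (Finset.mem_range.2 hxn)).trans (Nat.le_add_left _ _)
  rw [res_getD]
  constructor
  · rintro ⟨_, hA⟩
    exact hs x hA t hst
  · rintro ⟨y, hy, he, hz⟩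
    refine ⟨by omega, ?_⟩
    have : x ∈ enumOp (Wc c) (F ∪ {z | n ≤ z ∧ A z = true}) := by
      refine ⟨y, ⟨_, he⟩, fun z hzy => ?_⟩
      rw [Dfin_eq] at hzy
      rcases hz z hzy with h1 | ⟨h1, h2⟩
      · left; simpa using h1
      · right; exact ⟨h1, ((res_getD _ _ _).1 h2).2⟩
    rw [hE] at this
    exact this

theorem enumOp_mono {W X Y : Set ℕ} (h : X ⊆ Y) : enumOp W X ⊆ enumOp W Y := by
  rintro x ⟨y, h1, h2⟩
  exact ⟨y, h1, h2.trans h⟩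

/-! ### Diagonalization -/

theorem step (A : ℕ → Bool) (hinf : (toSet A).Infinite) (W : Set ℕ)
    (hW : ∀ (F : Finset ℕ) (n₀ : ℕ),
      ∃ n, n₀ ≤ n ∧ enumOp W (F ∪ {z | n ≤ z ∧ A z = true}) ≠ toSet A)
    (p : Finset ℕ × ℕ) :
    ∃ q : Finset ℕ × ℕ, p.1 ⊆ q.1 ∧ (q.1 : Set ℕ) ⊆ p.1 ∪ {z | p.2 ≤ z ∧ A z = true} ∧
      p.2 < q.2 ∧ (∃ a ∈ q.1, p.2 ≤ a) ∧
      ∀ Y : Set ℕ, (q.1 : Set ℕ) ⊆ Y → Y ⊆ q.1 ∪ {z | q.2 ≤ z ∧ A z = true} →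
        enumOp W Y ≠ toSet A := by
  classical
  obtain ⟨F, n₀⟩ := p
  obtain ⟨n, hn, hne⟩ := hW F n₀
  -- a weaker step, before adding a new element
  obtain ⟨F', n', h1, h2, h3, h4⟩ : ∃ (F' : Finset ℕ) (n' : ℕ), F ⊆ F' ∧
      (F' : Set ℕ) ⊆ F ∪ {z | n₀ ≤ z ∧ A z = true} ∧ n₀ ≤ n' ∧
      ∀ Y : Set ℕ, (F' : Set ℕ) ⊆ Y → Y ⊆ F' ∪ {z | n' ≤ z ∧ A z = true} →
        enumOp W Y ≠ toSet A := by
    by_cases hsub : enumOp W (F ∪ {z | n ≤ z ∧ A z = true}) ⊆ toSet A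
    · refine ⟨F, n, subset_rfl, Set.subset_union_left, hn, fun Y _ hY he => hne ?_⟩
      exact subset_antisymm hsub (he ▸ enumOp_mono hY)
    · obtain ⟨x, ⟨y, hy, hD⟩, hx⟩ := Set.not_subset.1 hsub
      refine ⟨F ∪ Denumerable.ofNat (Finset ℕ) y, n₀, Finset.subset_union_left, ?_, le_rfl, ?_⟩
      · rw [Finset.coe_union]
        refine Set.union_subset Set.subset_union_left (Set.Subset.trans hD ?_)
        refine Set.union_subset_union_right _ fun z hz => ⟨hn.trans hz.1, hz.2⟩
      · intro Y hY _ he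
        apply hx
        rw [← he]
        refine ⟨y, hy, Set.Subset.trans ?_ hY⟩
        rw [Finset.coe_union]
        exact Set.subset_union_right
  obtain ⟨a, ha, han⟩ := hinf.exists_gt n'
  refine ⟨(insert a F', a + 1), ?_, ?_, ?_, ⟨a, by simp, ?_⟩, ?_⟩
  · exact h1.trans (Finset.subset_insert _ _)
  · rw [Finset.coe_insert]
    exact Set.insert_subset (Or.inr ⟨by simp; omega, ha⟩) h2
  · simp; omega
  · simp; omega
  · intro Y hY1 hY2
    refine h4 Y (Set.Subset.trans (by simp) hY1) fun z hz => ?_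
    rcases hY2 hz with h | ⟨h, h'⟩
    · rcases Finset.mem_insert.1 (Finset.mem_coe.1 h) with rfl | h
      · exact Or.inr ⟨han.le, ha⟩
      · exact Or.inl h
    · simp only at h
      exact Or.inr ⟨by omega, h'⟩

end S19

/-- No 1-random set is introenumerable. -/
theorem stmt_19 (μ : Measure (ℕ → Bool)) (hμ : IsCoinMeasure μ)
    (A : ℕ → Bool) (h : MLRandom μ A) : ¬ Introenum (toSet A) := by
  rintro ⟨hinf, hI⟩
  have hst := fun i : ℕ => S19.step A hinf (S19.Wc (Denumerable.ofNat Code i))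
    (S19.key μ hμ A h (Denumerable.ofNat Code i))
  choose g hg1 hg2 hg3 hg4 hg5 using hst
  let q : ℕ → Finset ℕ × ℕ := fun i => Nat.rec (∅, 0) (fun i p => g i p) i
  have hq : ∀ i, q (i + 1) = g i (q i) := fun i => rfl
  have hm1 : Monotone fun i => (q i).1 := monotone_nat_of_le_succ fun i => by
    simp only [hq]; exact hg1 _ _
  have hm2 : StrictMono fun i => (q i).2 := strictMono_nat_of_lt_succ fun i => by
    simp only [hq]; exact hg3 _ _
  have hin : ∀ i j, i ≤ j → ((q j).1 : Set ℕ) ⊆ (q i).1 ∪ {z | (q i).2 ≤ z ∧ A z = true} := by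
    intro i j hij
    induction j, hij using Nat.le_induction with
    | base => exact Set.subset_union_left
    | succ j hij ih =>
      rw [hq]
      refine (hg2 j (q j)).trans (Set.union_subset ih fun z hz => Or.inr ⟨?_, hz.2⟩)
      exact (hm2.monotone hij).trans hz.1
  let Y : Set ℕ := ⋃ i, ((q i).1 : Set ℕ)
  have hY1 : ∀ i, ((q i).1 : Set ℕ) ⊆ Y := fun i => Set.subset_iUnion (fun i => ((q i).1 : Set ℕ)) i
  have hY2 : ∀ i, Y ⊆ (q i).1 ∪ {z | (q i).2 ≤ z ∧ A z = true} := by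
    intro i
    refine Set.iUnion_subset fun j => ?_
    rcases le_total i j with hij | hij
    · exact hin i j hij
    · exact Set.Subset.trans (Finset.coe_subset.2 (hm1 hij)) Set.subset_union_left
  have hYA : Y ⊆ toSet A := by
    intro z hz
    rcases hY2 0 hz with h0 | h0
    · simp [q] at h0
    · exact h0.2
  have hYinf : Y.Infinite := by
    rw [Set.infinite_iff_exists_gt]
    intro n
    obtain ⟨a, ha, hna⟩ := hg4 (n + 1) (q (n + 1))
    refine ⟨a, hY1 (n + 1 + 1) (by rw [hq]; exact ha), ?_⟩
    have : n + 1 ≤ (q (n + 1)).2 := hm2.id_le (n + 1)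
    omega
  obtain ⟨W, hW, he⟩ := hI Y hYA hYinf
  obtain ⟨c, rfl⟩ := S19.CE_code hW
  have := hg5 (Encodable.encode c) (q (Encodable.encode c)) Y
    (hY1 (Encodable.encode c + 1)) (hY2 (Encodable.encode c + 1))
  rw [Denumerable.ofNat_encode] at this
  exact this he
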